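/- Let k ≥ 2 and let Γ be a saturated convex precolored Θ^k-drawing of a graph G on n ≥ 2k − 1 vertices. Then G has at least k(n − 2k + 1)/(2k − 3) + n edges, i.e., (2k−3)·(|E(G)| − n) ≥ k(n − 2k + 1). -/

import Mathlib

/-- Points of the plane. -/
abbrev Pt : Type := ℝ × ℝ

/-- Two straight-line segments cross if some point lies in the interior
(open segment) of both. -/
def SegCross (a b c d : Pt) : Prop :=
  ∃ x : Pt, x ∈ openSegment ℝ a b ∧ x ∈ openSegment ℝ c d

/-- Two edges (unordered pairs of vertices) cross in the drawing `p`. -/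
def EdgeCross {V : Type} (p : V → Pt) (e f : Sym2 V) : Prop :=
  ∃ u v x y : V, e = s(u, v) ∧ f = s(x, y) ∧ SegCross (p u) (p v) (p x) (p y)

/-- The drawing `p` is injective and no three vertex points are collinear. -/
def GenPos {V : Type} (p : V → Pt) : Prop :=
  Function.Injective p ∧
    ∀ u v w : V, u ≠ v → u ≠ w → v ≠ w → ¬ Collinear ℝ ({p u, p v, p w} : Set Pt)

/-- The vertex points are in convex position: every vertex point is an extreme
point of the convex hull of all vertex points. -/
def ConvexPos {V : Type} (p : V → Pt) : Prop :=
  ∀ v : V, p v ∈ Set.extremePoints ℝ (convexHull ℝ (Set.range p))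

/-- A `k`-coloring of the edges of `G` is crossing-free if no two distinct
edges of the same color cross. -/
def CrossingFree {V : Type} {k : ℕ} (G : SimpleGraph V) (p : V → Pt)
    (φ : Sym2 V → Fin k) : Prop :=
  ∀ e ∈ G.edgeSet, ∀ f ∈ G.edgeSet, e ≠ f → φ e = φ f → ¬ EdgeCross p e f

open scoped Classical

/-- A precolored drawing `(G, p, φ)` is saturated: for every pair of distinct
non-adjacent vertices and every color `c`, assigning color `c` to the new edge
`uv` yields a coloring that is not crossing-free. -/
def PrecoloredSaturated {V : Type} {k : ℕ} (G : SimpleGraph V) (p : V → Pt)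
    (φ : Sym2 V → Fin k) : Prop :=
  ∀ u v : V, u ≠ v → ¬ G.Adj u v → ∀ c : Fin k,
    ¬ CrossingFree (G ⊔ SimpleGraph.fromEdgeSet {s(u, v)}) p
      (fun e => if e = s(u, v) then c else φ e)

/-- A (non-precolored) drawing of `G` is saturated for thickness `k`: for every
pair of distinct non-adjacent vertices `u, v`, the drawing of `G + uv` admits
no crossing-free `k`-coloring. -/
def Saturated {V : Type} (k : ℕ) (G : SimpleGraph V) (p : V → Pt) : Prop :=
  ∀ u v : V, u ≠ v → ¬ G.Adj u v →
    ∀ φ : Sym2 V → Fin k,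
      ¬ CrossingFree (G ⊔ SimpleGraph.fromEdgeSet {s(u, v)}) p φ

/-- Twice the signed area of the triangle `a b c`. -/
def det2 (a b c : Pt) : ℝ :=
  (b.1 - a.1) * (c.2 - a.2) - (b.2 - a.2) * (c.1 - a.1)

/-- An edge is an outer edge if its endpoints are consecutive on the boundary
of the convex hull of the vertex points, i.e. all other vertex points lie
strictly on one side of the line through its endpoints. -/
def IsOuterEdge {V : Type} (p : V → Pt) (e : Sym2 V) : Prop :=
  ∃ u v : V, e = s(u, v) ∧
    ((∀ w : V, w ≠ u → w ≠ v → 0 < det2 (p u) (p v) (p w)) ∨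
     (∀ w : V, w ≠ u → w ≠ v → det2 (p u) (p v) (p w) < 0))

lemma det_ne {n : ℕ} {p : Fin n → Pt} (hgen : GenPos p) {u v w : Fin n} (huv : u ≠ v)
    (huw : u ≠ w) (hvw : v ≠ w) : det2 (p u) (p v) (p w) ≠ 0 := by
  intro h
  apply hgen.2 u v w huv huw hvw
  have hne : p u ≠ p v := fun h => huv (hgen.1 h)
  rw [collinear_iff_of_mem (p₀ := p u) (by simp)]
  refine ⟨p v - p u, ?_⟩
  unfold det2 at h
  intro x hx
  simp only [Set.mem_insert_iff, Set.mem_singleton_iff] at hx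
  rcases hx with rfl | rfl | rfl
  · exact ⟨0, by simp⟩
  · exact ⟨1, by simp⟩
  · by_cases h1 : (p v).1 - (p u).1 = 0
    · have h2 : (p v).2 - (p u).2 ≠ 0 := by
        intro h2
        exact hne (Prod.ext (by linarith) (by linarith))
      refine ⟨((p w).2 - (p u).2) / ((p v).2 - (p u).2), ?_⟩
      rw [h1] at h
      have h3 : (p w).1 - (p u).1 = 0 := by
        rcases mul_eq_zero.1 (show ((p v).2 - (p u).2) * ((p w).1 - (p u).1) = 0 by linarith)
          with h | h
        · exact absurd h h2
        · exact h
      ext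
      · simp [h1]; linarith
      · simp; field_simp; ring
    · refine ⟨((p w).1 - (p u).1) / ((p v).1 - (p u).1), ?_⟩
      ext
      · simp; field_simp; ring
      · simp; field_simp; linarith

lemma no_inside {n : ℕ} {p : Fin n → Pt} (hconv : ConvexPos p) {w a b c : Fin n}
    (h1 : 0 < det2 (p w) (p a) (p b)) (h2 : 0 < det2 (p w) (p b) (p c))
    (h3 : 0 < det2 (p w) (p c) (p a)) : False := by
  have hw := hconv w
  rw [mem_extremePoints] at hw
  have hm : ∀ v, p v ∈ convexHull ℝ (Set.range p) := fun v => subset_convexHull _ _ ⟨v, rfl⟩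
  set C := det2 (p w) (p a) (p b) with hC
  set A := det2 (p w) (p b) (p c) with hA
  set B := det2 (p w) (p c) (p a) with hB
  have hz : (B / (B + C)) • p b + (C / (B + C)) • p c ∈ convexHull ℝ (Set.range p) :=
    convex_convexHull ℝ _ (hm b) (hm c) (by positivity) (by positivity) (by field_simp)
  have hs : p w ∈ openSegment ℝ (p a) ((B / (B + C)) • p b + (C / (B + C)) • p c) := by
    refine ⟨A / (A + B + C), (B + C) / (A + B + C), by positivity, by positivity,
      by field_simp; ring, ?_⟩
    have hpos : A + B + C ≠ 0 := by positivity
    have hpos' : B + C ≠ 0 := by positivity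
    ext
    · simp
      field_simp
      simp only [hA, hB, hC, det2]
      ring
    · simp
      field_simp
      simp only [hA, hB, hC, det2]
      ring
  have := (hw.2 _ (hm a) _ hz hs).1
  rw [hC, this] at h1
  simp [det2] at h1

lemma exists_order {n : ℕ} (hn : 0 < n) {p : Fin n → Pt} (hgen : GenPos p)
    (hconv : ConvexPos p) :
    ∃ σ : Fin n ≃ Fin n, ∀ i j l, i < j → j < l →
      0 < det2 (p (σ i)) (p (σ j)) (p (σ l)) := by
  let o : Fin n := ⟨0, hn⟩
  let R : Fin n → Fin n → Prop := fun u v =>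
    (u = o ∧ v ≠ o) ∨ (u ≠ o ∧ v ≠ o ∧ 0 < det2 (p o) (p u) (p v))
  have irr : ∀ u, ¬ R u u := by
    rintro u (⟨h, h'⟩ | ⟨_, _, h⟩)
    · exact h' h
    · simp only [det2] at h; linarith
  have tot : ∀ u v, u ≠ v → R u v ∨ R v u := by
    intro u v huv
    by_cases hu : u = o
    · left; left; exact ⟨hu, fun h => huv (hu.trans h.symm)⟩
    by_cases hv : v = o
    · right; left; exact ⟨hv, hu⟩
    rcases lt_or_gt_of_ne (det_ne hgen (Ne.symm hu) (Ne.symm hv) huv) with h | h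
    · right; right; refine ⟨hv, hu, ?_⟩; simp only [det2] at h ⊢; linarith
    · left; right; exact ⟨hu, hv, h⟩
  have tr : ∀ u v w, R u v → R v w → R u w := by
    rintro u v w (⟨h1, h2⟩ | ⟨h1, h2, h3⟩) (⟨h4, h5⟩ | ⟨h4, h5, h6⟩)
    · exact absurd h4 h2
    · exact Or.inl ⟨h1, h5⟩
    · exact absurd h4 h2
    · have huw : u ≠ w := by
        rintro rfl
        simp only [det2] at h3 h6; linarith
      refine Or.inr ⟨h1, h5, ?_⟩
      rcases lt_or_gt_of_ne (det_ne hgen (Ne.symm h1) (Ne.symm h5) huw) with h | h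
      · exact (no_inside hconv h3 h6 (by simp only [det2] at h ⊢; linarith)).elim
      · exact h
  have pos3 : ∀ u v w, R u v → R v w → 0 < det2 (p u) (p v) (p w) := by
    intro u v w h1 h2
    have h3 := tr _ _ _ h1 h2
    have nuv : u ≠ v := fun h => irr v (h ▸ h1)
    have nvw : v ≠ w := fun h => irr w (h ▸ h2)
    have nuw : u ≠ w := fun h => irr w (h ▸ h3)
    rcases h1 with ⟨g1, g2⟩ | ⟨g1, g2, g3⟩
    · rcases h2 with ⟨g4, g5⟩ | ⟨g4, g5, g6⟩
      · exact absurd g4 g2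
      · rw [g1]; exact g6
    · rcases h2 with ⟨g4, g5⟩ | ⟨g4, g5, g6⟩
      · exact absurd g4 g2
      · rcases lt_or_gt_of_ne (det_ne hgen nuv nuw nvw) with h | h
        · exfalso
          refine no_inside hconv (w := v) (a := o) (b := u) (c := w) ?_ ?_ ?_ <;>
            simp only [det2] at * <;> linarith
        · exact h
  let r : Fin n → Fin n := fun v => ⟨(Finset.univ.filter (fun w => R w v)).card, by
    have : (Finset.univ.filter (fun w => R w v)) ⊂ Finset.univ := by
      rw [Finset.ssubset_univ_iff]
      intro h
      have := Finset.mem_univ v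
      rw [← h] at this
      exact irr v (Finset.mem_filter.1 this).2
    simpa using Finset.card_lt_card this⟩
  have rlt : ∀ u v, R u v → r u < r v := by
    intro u v h
    change (Finset.univ.filter (fun w => R w u)).card < (Finset.univ.filter (fun w => R w v)).card
    apply Finset.card_lt_card
    rw [Finset.ssubset_iff_of_subset]
    · exact ⟨u, by simpa using h, by simpa using irr u⟩
    · intro w hw
      simp only [Finset.mem_filter, Finset.mem_univ, true_and] at hw ⊢
      exact tr _ _ _ hw h
  have rinj : Function.Injective r := by
    intro u v h
    by_contra hne
    rcases tot u v hne with h' | h'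
    · exact absurd h (rlt _ _ h').ne
    · exact absurd h (rlt _ _ h').ne'
  let e := Equiv.ofBijective r (Finite.injective_iff_bijective.1 rinj)
  have key : ∀ i j, i < j → R (e.symm i) (e.symm j) := by
    intro i j hij
    rcases tot (e.symm i) (e.symm j) (by simpa using hij.ne) with h | h
    · exact h
    · have h' : e (e.symm j) < e (e.symm i) := rlt _ _ h
      simp only [Equiv.apply_symm_apply] at h'
      exact absurd hij h'.not_gt
  exact ⟨e.symm, fun i j l h1 h2 => pos3 _ _ _ (key _ _ h1) (key _ _ h2)⟩

/-- interleaving pairs -/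
def Ilv {α : Type} [LinearOrder α] (a b c d : α) : Prop :=
  (a < c ∧ c < b ∧ b < d) ∨ (c < a ∧ a < d ∧ d < b)

lemma segCross_of_lt {a b c d : Pt} (h1 : 0 < det2 a b c) (h2 : 0 < det2 a b d)
    (h3 : 0 < det2 a c d) (h4 : 0 < det2 b c d) : SegCross a c b d := by
  have e1 : det2 a b c + det2 a c d ≠ 0 := by positivity
  have e2 : det2 a b d + det2 b c d ≠ 0 := by positivity
  refine ⟨(det2 b c d / (det2 a b d + det2 b c d)) • a +
    (det2 a b d / (det2 a b d + det2 b c d)) • c,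
    ⟨_, _, by positivity, by positivity, by field_simp; ring, rfl⟩,
    ⟨det2 a c d / (det2 a b c + det2 a c d), det2 a b c / (det2 a b c + det2 a c d),
      by positivity, by positivity, by field_simp; ring, ?_⟩⟩
  have e3 : det2 a b c + det2 a c d = det2 a b d + det2 b c d := by simp only [det2]; ring
  rw [e3]
  ext
  · simp
    field_simp
    simp only [det2]; ring
  · simp
    field_simp
    simp only [det2]; ring

lemma SegCross.symm' {a b c d : Pt} (h : SegCross a b c d) : SegCross c d a b := by
  obtain ⟨x, h1, h2⟩ := h
  exact ⟨x, h2, h1⟩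

lemma segCross_of_inter {n : ℕ} {q : Fin n → Pt}
    (hq : ∀ i j l, i < j → j < l → 0 < det2 (q i) (q j) (q l)) {a b c d : Fin n}
    (h : Ilv a b c d) : SegCross (q a) (q b) (q c) (q d) := by
  rcases h with ⟨h1, h2, h3⟩ | ⟨h1, h2, h3⟩
  · exact segCross_of_lt (hq _ _ _ h1 h2) (hq _ _ _ h1 (h2.trans h3))
      (hq _ _ _ (h1.trans h2) h3) (hq _ _ _ h2 h3)
  · exact (segCross_of_lt (hq _ _ _ h1 h2) (hq _ _ _ h1 (h2.trans h3))
      (hq _ _ _ (h1.trans h2) h3) (hq _ _ _ h2 h3)).symm'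

lemma inter_of_segCross {n : ℕ} {q : Fin n → Pt}
    (hq : ∀ i j l, i < j → j < l → 0 < det2 (q i) (q j) (q l)) {a b c d : Fin n}
    (hab : a < b) (hcd : c < d) (hne : ¬ (a = c ∧ b = d))
    (h : SegCross (q a) (q b) (q c) (q d)) : Ilv a b c d := by
  obtain ⟨x, ⟨s, t, hs, ht, hst, hx⟩, ⟨s', t', hs', ht', hst', hx'⟩⟩ := h
  have key : s' * det2 (q a) (q b) (q c) + t' * det2 (q a) (q b) (q d) = 0 := by
    have h1 := congrArg Prod.fst (hx.trans hx'.symm)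
    have h2 := congrArg Prod.snd (hx.trans hx'.symm)
    simp at h1 h2
    have hs1 : s = 1 - t := by linarith
    have hs2 : s' = 1 - t' := by linarith
    subst hs1 hs2
    simp only [det2]
    linear_combination (-((q b).1 - (q a).1)) * h2 + ((q b).2 - (q a).2) * h1
  have pos : ∀ z, (z < a ∨ b < z) → 0 < det2 (q a) (q b) (q z) := by
    rintro z (h | h)
    · have := hq _ _ _ h hab
      simp only [det2] at this ⊢; linarith
    · exact hq _ _ _ hab h
  have neg : ∀ z, (a < z ∧ z < b) → det2 (q a) (q b) (q z) < 0 := by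
    rintro z ⟨h, h'⟩
    have := hq _ _ _ h h'
    simp only [det2] at this ⊢; linarith
  have zero : ∀ z, (z = a ∨ z = b) → det2 (q a) (q b) (q z) = 0 := by
    rintro z (rfl | rfl) <;> simp only [det2] <;> ring
  have cl : ∀ z, (z < a ∨ b < z) ∨ (a < z ∧ z < b) ∨ (z = a ∨ z = b) := by
    intro z; omega
  unfold Ilv
  rcases cl c with hc | hc | hc <;> rcases cl d with hd | hd | hd
  · have := mul_pos hs' (pos _ hc); have := mul_pos ht' (pos _ hd); linarith
  · omega
  · have := mul_pos hs' (pos _ hc); rw [zero _ hd] at key; linarith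
  · omega
  · have := mul_neg_of_pos_of_neg hs' (neg _ hc)
    have := mul_neg_of_pos_of_neg ht' (neg _ hd); linarith
  · have := mul_neg_of_pos_of_neg hs' (neg _ hc); rw [zero _ hd] at key; linarith
  · have := mul_pos ht' (pos _ hd); rw [zero _ hc] at key; linarith
  · have := mul_neg_of_pos_of_neg ht' (neg _ hd); rw [zero _ hc] at key; linarith
  · omega

lemma face_bound {n : ℕ} (B : ℕ) : ∀ (m : ℕ) (S : Finset (Fin n)) (D : Finset (Fin n × Fin n)),
    D.card = m →
    (∀ d ∈ D, d.1 < d.2 ∧ d.1 ∈ S ∧ d.2 ∈ S) →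
    (∀ d ∈ D, ∀ e ∈ D, ¬ Ilv d.1 d.2 e.1 e.2) →
    (∀ T ⊆ S, (∀ x ∈ T, ∀ y ∈ T, x < y → ∀ d ∈ D, ¬ Ilv x y d.1 d.2) → T.card ≤ B + 2) →
    S.card ≤ B * (m + 1) + 2 := by
  intro m
  induction m using Nat.strong_induction_on with
  | _ m ih =>
  intro S D hm hD hX hT
  rcases D.eq_empty_or_nonempty with rfl | ⟨⟨a, b⟩, hab⟩
  · simp at hm
    subst hm
    simpa using hT S (Finset.Subset.refl _) (by simp)
  obtain ⟨hlt, haS, hbS⟩ := hD _ hab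
  simp only at hlt haS hbS
  let P : Fin n × Fin n → Prop := fun d => a ≤ d.1 ∧ d.2 ≤ b
  let D1 := (D.erase (a, b)).filter P
  let D2 := (D.erase (a, b)).filter (fun d => ¬ P d)
  let S1 := S.filter (fun x => a ≤ x ∧ x ≤ b)
  let S2 := S.filter (fun x => x ≤ a ∨ b ≤ x)
  have hc : D1.card + D2.card = m - 1 := by
    rw [← hm, ← Finset.card_erase_of_mem hab]
    exact Finset.card_filter_add_card_filter_not _
  have hm0 : 0 < m := hm ▸ Finset.card_pos.2 ⟨_, hab⟩
  have hS : S1.card + S2.card = S.card + 2 := by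
    rw [← Finset.card_union_add_card_inter]
    have h1 : S1 ∪ S2 = S := by
      ext x
      simp only [S1, S2, Finset.mem_union, Finset.mem_filter]
      have : (a ≤ x ∧ x ≤ b) ∨ (x ≤ a ∨ b ≤ x) := by omega
      tauto
    have h2 : S1 ∩ S2 = {a, b} := by
      ext x
      simp only [S1, S2, Finset.mem_inter, Finset.mem_filter, Finset.mem_insert,
        Finset.mem_singleton]
      constructor
      · rintro ⟨⟨_, h1, h2⟩, _, h3⟩; omega
      · rintro (rfl | rfl)
        · exact ⟨⟨haS, le_refl _, hlt.le⟩, haS, Or.inl (le_refl _)⟩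
        · exact ⟨⟨hbS, hlt.le, le_refl _⟩, hbS, Or.inr (le_refl _)⟩
    rw [h1, h2, Finset.card_pair hlt.ne]
  have mem1 : ∀ d ∈ D1, d ∈ D ∧ a ≤ d.1 ∧ d.2 ≤ b := by
    intro d hd
    obtain ⟨h1, h2⟩ := Finset.mem_filter.1 hd
    exact ⟨Finset.mem_of_mem_erase h1, h2⟩
  have mem2 : ∀ d ∈ D2, d ∈ D ∧ (d.1 ≤ a ∨ b ≤ d.1) ∧ (d.2 ≤ a ∨ b ≤ d.2) := by
    intro d hd
    obtain ⟨h1, h2⟩ := Finset.mem_filter.1 hd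
    have h3 := Finset.mem_of_mem_erase h1
    refine ⟨h3, ?_⟩
    have h4 := hX _ hab _ h3
    have h5 := (hD _ h3).1
    simp only [P, Ilv] at h2 h4
    omega
  have memD : ∀ d ∈ D, d = (a, b) ∨ d ∈ D1 ∨ d ∈ D2 := by
    intro d hd
    by_cases h : d = (a, b)
    · exact Or.inl h
    · right
      by_cases hP : P d
      · left; exact Finset.mem_filter.2 ⟨Finset.mem_erase.2 ⟨h, hd⟩, hP⟩
      · right; exact Finset.mem_filter.2 ⟨Finset.mem_erase.2 ⟨h, hd⟩, hP⟩
  have r1 := ih D1.card (by omega) S1 D1 rfl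
    (fun d hd => by
      obtain ⟨h1, h2, h3⟩ := mem1 d hd
      obtain ⟨h4, h5, h6⟩ := hD d h1
      exact ⟨h4, Finset.mem_filter.2 ⟨h5, h2, by omega⟩, Finset.mem_filter.2 ⟨h6, by omega, h3⟩⟩)
    (fun d hd e he => hX d (mem1 d hd).1 e (mem1 e he).1)
    (fun T hTS hTD => hT T (hTS.trans (Finset.filter_subset _ _)) (by
      intro x hx y hy hxy d hd
      have hx' := (Finset.mem_filter.1 (hTS hx)).2
      have hy' := (Finset.mem_filter.1 (hTS hy)).2
      rcases memD d hd with rfl | h | h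
      · simp only [Ilv]; omega
      · exact hTD x hx y hy hxy d h
      · have := mem2 d h
        simp only [Ilv]; omega))
  have r2 := ih D2.card (by omega) S2 D2 rfl
    (fun d hd => by
      obtain ⟨h1, h2, h3⟩ := mem2 d hd
      obtain ⟨h4, h5, h6⟩ := hD d h1
      exact ⟨h4, Finset.mem_filter.2 ⟨h5, h2⟩, Finset.mem_filter.2 ⟨h6, h3⟩⟩)
    (fun d hd e he => hX d (mem2 d hd).1 e (mem2 e he).1)
    (fun T hTS hTD => hT T (hTS.trans (Finset.filter_subset _ _)) (by
      intro x hx y hy hxy d hd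
      have hx' := (Finset.mem_filter.1 (hTS hx)).2
      have hy' := (Finset.mem_filter.1 (hTS hy)).2
      rcases memD d hd with rfl | h | h
      · simp only [Ilv]; omega
      · have := mem1 d h
        simp only [Ilv]; omega
      · exact hTD x hx y hy hxy d h))
  have hmm : m = D1.card + D2.card + 1 := by omega
  have : B * (m + 1) = B * (D1.card + 1) + B * (D2.card + 1) := by rw [hmm]; ring
  omega

/-- Every saturated convex precolored Θ^k-drawing (`k ≥ 2`) of a
graph on `n ≥ 2k-1` vertices has at least `k(n-2k+1)/(2k-3) + n` edges. -/
theorem stmt3 (n k : ℕ) (hk : 2 ≤ k) (hn : 2 * k - 1 ≤ n)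
    (G : SimpleGraph (Fin n)) (p : Fin n → Pt) (φ : Sym2 (Fin n) → Fin k)
    (hgen : GenPos p) (hconv : ConvexPos p)
    (hφ : CrossingFree G p φ) (hsat : PrecoloredSaturated G p φ) :
    (2 * (k : ℤ) - 3) * ((G.edgeSet.ncard : ℤ) - n) ≥
      (k : ℤ) * ((n : ℤ) - 2 * k + 1) := by
  obtain ⟨σ, hσ⟩ := exists_order (by omega) hgen hconv
  have cross_iff := fun {a b c d : Fin n} => @inter_of_segCross n (fun i => p (σ i)) hσ a b c d
  have cross_of := fun {a b c d : Fin n} => @segCross_of_inter n (fun i => p (σ i)) hσ a b c d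
  have sne : ∀ {a b c d : Fin n}, a < b → c < d → s(σ a, σ b) = s(σ c, σ d) → a = c ∧ b = d := by
    intro a b c d hab hcd h
    simp only [Sym2.eq_iff, σ.injective.eq_iff] at h
    omega
  -- edges in normal form
  have norm : ∀ u v : Fin n, u ≠ v → ∃ i j, i < j ∧ s(u, v) = s(σ i, σ j) := by
    intro u v huv
    have : σ.symm u ≠ σ.symm v := by simpa using huv
    rcases lt_or_gt_of_ne this with h | h
    · exact ⟨_, _, h, by simp⟩
    · exact ⟨_, _, h, by simp [Sym2.eq_swap]⟩
  have ecross : ∀ {a b c d : Fin n}, a < b → c < d → s(σ a, σ b) ≠ s(σ c, σ d) →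
      EdgeCross p s(σ a, σ b) s(σ c, σ d) → Ilv a b c d := by
    intro a b c d hab hcd hne ⟨u, v, x, y, h1, h2, h3⟩
    apply cross_iff hab hcd (by rintro ⟨rfl, rfl⟩; exact hne rfl)
    rw [Sym2.eq_iff] at h1 h2
    obtain ⟨z, hz1, hz2⟩ := h3
    refine ⟨z, ?_, ?_⟩
    · rcases h1 with ⟨rfl, rfl⟩ | ⟨rfl, rfl⟩
      · exact hz1
      · rw [openSegment_symm]; exact hz1
    · rcases h2 with ⟨rfl, rfl⟩ | ⟨rfl, rfl⟩
      · exact hz2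
      · rw [openSegment_symm]; exact hz2
  have interSymm : ∀ {a b c d : Fin n}, Ilv a b c d → Ilv c d a b := by
    intro a b c d h; simp only [Ilv] at h ⊢; tauto
  have ecross_symm : ∀ e f, EdgeCross p e f → EdgeCross p f e := by
    rintro e f ⟨u, v, x, y, h1, h2, h3⟩
    exact ⟨x, y, u, v, h2, h1, h3.symm'⟩
  have diffcol : ∀ {a b c d : Fin n}, a < b → c < d → G.Adj (σ a) (σ b) → G.Adj (σ c) (σ d) →
      Ilv a b c d → φ s(σ a, σ b) ≠ φ s(σ c, σ d) := by
    intro a b c d hab hcd h1 h2 h3 h4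
    refine hφ _ h1 _ h2 ?_ h4 ⟨_, _, _, _, rfl, rfl, cross_of h3⟩
    intro h
    obtain ⟨rfl, rfl⟩ := sne hab hcd h
    simp only [Ilv] at h3; omega
  have sat : ∀ {a b : Fin n}, a < b → ∀ c, (∀ i j, i < j → G.Adj (σ i) (σ j) →
      φ s(σ i, σ j) = c → ¬ Ilv a b i j) → G.Adj (σ a) (σ b) := by
    intro a b hab c hc
    by_contra hnadj
    have hne : σ a ≠ σ b := fun h => hab.ne (σ.injective h)
    apply hsat _ _ hne hnadj c
    have main : ∀ f ∈ G.edgeSet, f ≠ s(σ a, σ b) → φ f = c → ¬ EdgeCross p s(σ a, σ b) f := by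
      intro f hf hfne hfc hcr
      induction f using Sym2.ind with
      | _ x y =>
      obtain ⟨i, j, hij, he⟩ := norm x y (G.ne_of_adj hf)
      rw [he] at hf hfc hcr hfne
      exact hc i j hij hf hfc (ecross hab hij (Ne.symm hfne) hcr)
    have hsplit : ∀ e ∈ (G ⊔ SimpleGraph.fromEdgeSet {s(σ a, σ b)}).edgeSet,
        e = s(σ a, σ b) ∨ (e ≠ s(σ a, σ b) ∧ e ∈ G.edgeSet) := by
      intro e he
      by_cases h : e = s(σ a, σ b)
      · exact Or.inl h
      · right
        refine ⟨h, ?_⟩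
        rw [SimpleGraph.edgeSet_sup, SimpleGraph.edgeSet_fromEdgeSet] at he
        rcases he with he | he
        · exact he
        · exact absurd he.1 h
    intro e he f hf hef hcol hcr
    rcases hsplit e he with rfl | ⟨he1, he2⟩ <;> rcases hsplit f hf with rfl | ⟨hf1, hf2⟩
    · exact hef rfl
    · simp only [if_true, if_neg hf1] at hcol
      exact main f hf2 hf1 hcol.symm hcr
    · simp only [if_true, if_neg he1] at hcol
      exact main e he2 he1 hcol (ecross_symm _ _ hcr)
    · simp only [if_neg hf1, if_neg he1] at hcol
      exact hφ e he2 f hf2 hef hcol hcr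
  let F : Finset (Fin n × Fin n) :=
    Finset.univ.filter (fun d => d.1 < d.2 ∧ G.Adj (σ d.1) (σ d.2))
  let Out : Fin n × Fin n → Prop := fun d =>
    d.1.val + 1 = d.2.val ∨ (d.1.val = 0 ∧ d.2.val + 1 = n)
  have outX : ∀ a b c d : Fin n, a < b → c < d → Out (a, b) → ¬ Ilv a b c d := by
    intro a b c d hab hcd h h'
    simp only [Out, Ilv] at h h'
    omega
  have hFE : F.card ≤ G.edgeSet.ncard := by
    rw [← Set.ncard_coe_finset]
    apply Set.ncard_le_ncard_of_injOn (fun d => s(σ d.1, σ d.2))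
    · intro d hd
      simp only [F, Finset.coe_filter, Finset.mem_univ, true_and, Set.mem_ofPred_eq] at hd
      exact hd.2
    · intro d hd e he h
      simp only [F, Finset.coe_filter, Finset.mem_univ, true_and, Set.mem_ofPred_eq] at hd he
      exact Prod.ext_iff.2 (sne hd.1 he.1 h)
  have hout : n ≤ (F.filter Out).card := by
    let g : Fin n → Fin n × Fin n := fun i =>
      if h : i.val + 1 < n then (i, ⟨i.val + 1, h⟩) else (⟨0, by omega⟩, i)
    have hg : ∀ i, (g i).1 < (g i).2 ∧ Out (g i) := by
      intro i
      by_cases h : i.val + 1 < n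
      · have e : g i = (i, ⟨i.val + 1, h⟩) := dif_pos h
        rw [e]
        exact ⟨Fin.lt_def.2 (Nat.lt_succ_self _), Or.inl rfl⟩
      · have e : g i = (⟨0, by omega⟩, i) := dif_neg h
        rw [e]
        exact ⟨Fin.lt_def.2 (show 0 < i.val by omega), Or.inr ⟨rfl, by
          show i.val + 1 = n
          omega⟩⟩
    have ginj : Function.Injective g := by
      intro i j h
      simp only [g] at h
      split_ifs at h <;> simp only [Prod.mk.injEq, Fin.ext_iff] at h ⊢ <;> omega
    have : (Finset.univ.image g) ⊆ F.filter Out := by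
      intro d hd
      obtain ⟨i, -, rfl⟩ := Finset.mem_image.1 hd
      refine Finset.mem_filter.2 ⟨Finset.mem_filter.2 ⟨Finset.mem_univ _, (hg i).1, ?_⟩, (hg i).2⟩
      exact sat (hg i).1 ⟨0, by omega⟩ (fun a b hab _ _ => outX _ _ _ _ (hg i).1 hab (hg i).2)
    have h2 := Finset.card_le_card this
    rw [Finset.card_image_of_injective _ ginj] at h2
    simpa using h2
  let D : Fin k → Finset (Fin n × Fin n) := fun c =>
    (F.filter (fun d => ¬ Out d)).filter (fun d => φ s(σ d.1, σ d.2) = c)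
  have hDsum : (F.filter (fun d => ¬ Out d)).card = ∑ c, (D c).card :=
    Finset.card_eq_sum_card_fiberwise (fun _ _ => Finset.mem_univ _)
  have memD : ∀ c d, d ∈ D c ↔
      ((d.1 < d.2 ∧ G.Adj (σ d.1) (σ d.2)) ∧ ¬ Out d) ∧ φ s(σ d.1, σ d.2) = c := by
    intro c d; simp [D, F]
  have hDc : ∀ c, n ≤ (2 * k - 3) * ((D c).card + 1) + 2 := by
    intro c
    have := face_bound (2 * k - 3) (D c).card Finset.univ (D c) rfl
      (fun d hd => ⟨((memD c d).1 hd).1.1.1, Finset.mem_univ _, Finset.mem_univ _⟩)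
      (fun d hd e he h => by
        have hd' := (memD c d).1 hd
        have he' := (memD c e).1 he
        exact diffcol hd'.1.1.1 he'.1.1.1 hd'.1.1.2 he'.1.1.2 h (hd'.2.trans he'.2.symm))
      ?_
    · simpa using this
    intro T _ hT
    by_contra hcard
    have hcard : 2 * k ≤ T.card := by omega
    have hadj : ∀ x ∈ T, ∀ y ∈ T, x < y → G.Adj (σ x) (σ y) := by
      intro x hx y hy hxy
      apply sat hxy c
      intro i j hij hG hcol h
      exact hT x hx y hy hxy (i, j) ((memD c _).2
        ⟨⟨⟨hij, hG⟩, fun ho => outX _ _ _ _ hij hxy ho (interSymm h)⟩, hcol⟩) h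
    let t := T.orderEmbOfFin rfl
    let lo : Fin k → Fin n := fun i => t ⟨i.val, by omega⟩
    let hi : Fin k → Fin n := fun i => t ⟨i.val + k, by omega⟩
    have hlo : ∀ i, lo i ∈ T := fun i => Finset.orderEmbOfFin_mem _ _ _
    have hhi : ∀ i, hi i ∈ T := fun i => Finset.orderEmbOfFin_mem _ _ _
    have hlh : ∀ i j, lo i < hi j := fun i j => t.strictMono (by simp only [Fin.lt_def]; omega)
    have hX : ∀ i j, i ≠ j → Ilv (lo i) (hi i) (lo j) (hi j) := by
      intro i j hij
      rcases lt_or_gt_of_ne hij with h | h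
      · exact Or.inl ⟨t.strictMono (by simp only [Fin.lt_def]; omega), hlh _ _,
          t.strictMono (by simp only [Fin.lt_def]; omega)⟩
      · exact Or.inr ⟨t.strictMono (by simp only [Fin.lt_def]; omega), hlh _ _,
          t.strictMono (by simp only [Fin.lt_def]; omega)⟩
    have hA : ∀ i, G.Adj (σ (lo i)) (σ (hi i)) := fun i => hadj _ (hlo i) _ (hhi i) (hlh i i)
    let col : Fin k → Fin k := fun i => φ s(σ (lo i), σ (hi i))
    have cinj : Function.Injective col := by
      intro i j h
      by_contra hne
      exact diffcol (hlh i i) (hlh j j) (hA i) (hA j) (hX i j hne) h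
    obtain ⟨i, hi'⟩ := Finite.injective_iff_surjective.1 cinj c
    obtain ⟨j, hj⟩ : ∃ j, j ≠ i := by
      have : Nontrivial (Fin k) := Fin.nontrivial_iff_two_le.2 hk
      exact exists_ne i
    exact hT _ (hlo j) _ (hhi j) (hlh j j) (lo i, hi i) ((memD c _).2
      ⟨⟨⟨hlh i i, hA i⟩, fun ho => outX _ _ _ _ (hlh i i) (hlh j j) ho (hX i j hj.symm)⟩, hi'⟩)
      (hX j i hj)
  have hsum : ∑ _c : Fin k, ((n : ℤ) - 2 * k + 1) ≤
      ∑ c : Fin k, (2 * (k : ℤ) - 3) * ((D c).card : ℤ) := by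
    apply Finset.sum_le_sum
    intro c _
    have h := hDc c
    have h' : (n : ℤ) ≤ (2 * (k : ℤ) - 3) * ((D c).card + 1) + 2 := by
      have e : ((2 * k - 3 : ℕ) : ℤ) = 2 * (k : ℤ) - 3 := by omega
      rw [← e]; exact_mod_cast h
    linarith
  rw [← Finset.mul_sum] at hsum
  simp only [Finset.sum_const, Finset.card_univ, Fintype.card_fin, nsmul_eq_mul] at hsum
  have htot : (F.filter Out).card + (F.filter (fun d => ¬ Out d)).card = F.card :=
    Finset.card_filter_add_card_filter_not _
  have hfin : (∑ c : Fin k, ((D c).card : ℤ)) ≤ (G.edgeSet.ncard : ℤ) - n := by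
    have : (∑ c : Fin k, ((D c).card : ℤ)) = ((F.filter (fun d => ¬ Out d)).card : ℤ) := by
      rw [hDsum]; push_cast; rfl
    rw [this]; omega
  have hk3 : (0 : ℤ) ≤ 2 * (k : ℤ) - 3 := by omega
  exact hsum.trans (mul_le_mul_of_nonneg_left hfin hk3)
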